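/- Exact flux balance: for every scatterer configuration ξ, every initial occupation configuration σ₀ : C_N → {0,1}, every i with |i| < N and every t ∈ ℕ, one has R·ρ^R(i,t+1) - R·ρ^R(i,t) = X_{(i+1)→i}(t) - X_{i→(i+1)}(t) + X_{(i-1)→i}(t) - X_{i→(i-1)}(t), where X_{i→(i+1)}(t) = #{k ∈ ℤ/Rℤ : σ(k,i;t) = 1, σ(k,i+1;t) = 0, J(k,i) = 1}, X_{(i+1)→i}(t) = #{k : σ(k,i+1;t) = 1, σ(k,i;t) = 0, J(k,i) = 1}, X_{i→(i-1)}(t) = #{k : σ(k,i;t) = 1, σ(k,i-1;t) = 0, J(k,i-1) = 1}, and X_{(i-1)→i}(t) = #{k : σ(k,i-1;t) = 1, σ(k,i;t) = 0, J(k,i-1) = 1}. -/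

import Mathlib

instance (R : ℕ) : Nonempty (ZMod R) := ⟨0⟩

/-- `J(k,i) = ξ(k,i)(1-ξ(k,i-1))(1-ξ(k,i+1))`. -/
def Jmap {R : ℕ} (ξ : ZMod R → ℤ → ℕ) (k : ZMod R) (i : ℤ) : ℕ :=
  ξ k i * (1 - ξ k (i - 1)) * (1 - ξ k (i + 1))

/-- The one-step dynamics `τ` : move one step ahead on the ring (first coordinate,
mod `R`), jumping to the neighbouring ring when exactly one scatterer is present. -/
def tau {R : ℕ} (ξ : ZMod R → ℤ → ℕ) (p : ZMod R × ℤ) : ZMod R × ℤ :=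
  if Jmap ξ p.1 p.2 = 1 then (p.1 + 1, p.2 + 1)
  else if Jmap ξ p.1 (p.2 - 1) = 1 then (p.1 + 1, p.2 - 1)
  else (p.1 + 1, p.2)

/-- A scatterer configuration: `{0,1}`-valued, vanishing outside `-N ≤ i ≤ N-1`. -/
def IsScatterer (N R : ℕ) (ξ : ZMod R → ℤ → ℕ) : Prop :=
  (∀ (k : ZMod R) (i : ℤ), ξ k i ≤ 1) ∧
  (∀ (k : ZMod R) (i : ℤ), (i < -(N : ℤ) ∨ (N : ℤ) ≤ i) → ξ k i = 0)

/-- The phase space `C_N = (ℤ/Rℤ) × {i : |i| ≤ N}` viewed inside `(ℤ/Rℤ) × ℤ`. -/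
def phase (N R : ℕ) : Set (ZMod R × ℤ) := {p | |p.2| ≤ (N : ℤ)}

/-- `τ^{-t}`, the `t`-th iterate of the inverse map `τ⁻¹`. -/
noncomputable def tauInvIter {R : ℕ} (ξ : ZMod R → ℤ → ℕ) (t : ℕ) :
    ZMod R × ℤ → ZMod R × ℤ :=
  (Function.invFun (tau ξ))^[t]

/-- The empirical density `ρ^R(i,t) = (1/R) Σ_k σ₀(τ⁻ᵗ(k,i))` on ring `i`. -/
noncomputable def empDens {R : ℕ} (ξc : ZMod R → ℤ → ℕ) (σc : ZMod R × ℤ → ℕ)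
    (i : ℤ) (t : ℕ) : ℝ :=
  (R : ℝ)⁻¹ * ∑ k ∈ Finset.range R, (σc (tauInvIter ξc t ((k : ZMod R), i)) : ℝ)

/-- `X_{i→(i+1)}(t)`: the number of `k` for which, at time `t`, a particle at
`(k,i)` jumps to ring `i+1` while no particle jumps from `(k,i+1)` to ring `i`. -/
noncomputable def fluxUp {R : ℕ} (ξc : ZMod R → ℤ → ℕ) (σc : ZMod R × ℤ → ℕ)
    (t : ℕ) (i : ℤ) : ℕ :=
  ((Finset.range R).filter fun k : ℕ =>
    σc (tauInvIter ξc t ((k : ZMod R), i)) = 1 ∧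
    σc (tauInvIter ξc t ((k : ZMod R), i + 1)) = 0 ∧
    Jmap ξc (k : ZMod R) i = 1).card

/-- `X_{i→(i-1)}(t)`: the number of `k` for which, at time `t`, a particle at
`(k,i)` jumps to ring `i-1` while no particle jumps from `(k,i-1)` to ring `i`. -/
noncomputable def fluxDown {R : ℕ} (ξc : ZMod R → ℤ → ℕ) (σc : ZMod R × ℤ → ℕ)
    (t : ℕ) (i : ℤ) : ℕ :=
  ((Finset.range R).filter fun k : ℕ =>
    σc (tauInvIter ξc t ((k : ZMod R), i)) = 1 ∧
    σc (tauInvIter ξc t ((k : ZMod R), i - 1)) = 0 ∧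
    Jmap ξc (k : ZMod R) (i - 1) = 1).card

theorem Jmap_succ_ne_one {R : ℕ} (ξ : ZMod R → ℤ → ℕ) {k : ZMod R} {i : ℤ}
    (h : Jmap ξ k i = 1) : Jmap ξ k (i + 1) ≠ 1 := by
  intro h'
  simp only [Jmap, mul_eq_one] at h h'
  omega

theorem tau_injective {R : ℕ} (ξ : ZMod R → ℤ → ℕ) : Function.Injective (tau ξ) := by
  rintro ⟨k, i⟩ ⟨l, j⟩ h
  have hk : k = l := by
    have h1 := congrArg Prod.fst h
    simp only [tau] at h1
    split_ifs at h1 <;> simpa using h1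
  subst hk
  have h2 := congrArg Prod.snd h
  have hJ : ∀ m n : ℤ, n = m + 1 → Jmap ξ k m = 1 → Jmap ξ k n ≠ 1 := by
    rintro m n rfl
    exact Jmap_succ_ne_one ξ
  have hij : i = j := by
    simp only [tau] at h2
    grind
  rw [hij]

theorem invFun_tau_add_one {R : ℕ} (ξ : ZMod R → ℤ → ℕ) (k : ZMod R) (i : ℤ) :
    Function.invFun (tau ξ) (k + 1, i) =
      if Jmap ξ k i = 1 then (k, i + 1)
      else if Jmap ξ k (i - 1) = 1 then (k, i - 1) else (k, i) := by
  have key : ∀ q, tau ξ q = (k + 1, i) → Function.invFun (tau ξ) (k + 1, i) = q :=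
    fun q hq => hq ▸ Function.leftInverse_invFun (tau_injective ξ) q
  apply key
  split_ifs with h1 h2
  · simp [tau, Jmap_succ_ne_one ξ h1, h1]
  · simp [tau, h2]
  · simp [tau, h1, h2]

theorem sum_range_natCast_zmod {R : ℕ} [NeZero R] {M : Type*} [AddCommMonoid M]
    (f : ZMod R → M) : ∑ k ∈ Finset.range R, f (k : ZMod R) = ∑ x : ZMod R, f x := by
  refine Finset.sum_bij' (fun k _ => (k : ZMod R)) (fun x _ => x.val) ?_ ?_ ?_ ?_ ?_
  · simp
  · simp [ZMod.val_lt]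
  · intro k hk
    exact ZMod.val_cast_of_lt (Finset.mem_range.mp hk)
  · simp
  · simp

/-- Exact flux balance: for `|i| < N`,
`R ρ^R(i,t+1) - R ρ^R(i,t) = X_{(i+1)→i} - X_{i→(i+1)} + X_{(i-1)→i} - X_{i→(i-1)}`,
where `X_{(i+1)→i}(t) = fluxDown _ _ t (i+1)` and `X_{(i-1)→i}(t) = fluxUp _ _ t (i-1)`. -/
theorem stmt17 (N R : ℕ) (hN : 1 ≤ N) (hR : 2 ≤ R)
    (ξ : ZMod R → ℤ → ℕ) (hξ : IsScatterer N R ξ)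
    (σ0 : ZMod R × ℤ → ℕ) (hσ0 : ∀ p, σ0 p ≤ 1)
    (i : ℤ) (hi : |i| < (N : ℤ)) (t : ℕ) :
    (R : ℝ) * empDens ξ σ0 i (t + 1) - (R : ℝ) * empDens ξ σ0 i t =
      (fluxDown ξ σ0 t (i + 1) : ℝ) - (fluxUp ξ σ0 t i : ℝ)
        + (fluxUp ξ σ0 t (i - 1) : ℝ) - (fluxDown ξ σ0 t i : ℝ) := by
  have : NeZero R := ⟨by omega⟩
  have hR0 : (R : ℝ) ≠ 0 := NeZero.ne _
  set s : ZMod R × ℤ → ℕ := fun q => σ0 (tauInvIter ξ t q) with hs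
  have hs1 : ∀ q, s q = 0 ∨ s q = 1 := fun q => by
    have := hσ0 (tauInvIter ξ t q)
    simp only [hs]
    omega
  have hnow : (R : ℝ) * empDens ξ σ0 i t = ∑ k : ZMod R, (s (k, i) : ℝ) := by
    rw [empDens, mul_inv_cancel_left₀ hR0, ← sum_range_natCast_zmod]
  have hnext : (R : ℝ) * empDens ξ σ0 i (t + 1) =
      ∑ k : ZMod R, (s (Function.invFun (tau ξ) (k + 1, i)) : ℝ) := by
    rw [empDens, mul_inv_cancel_left₀ hR0,
      sum_range_natCast_zmod fun k => (σ0 (tauInvIter ξ (t + 1) (k, i)) : ℝ),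
      ← Equiv.sum_comp (Equiv.addRight (1 : ZMod R))]
    rfl
  have hup : ∀ j, (fluxUp ξ σ0 t j : ℝ) = ∑ k : ZMod R,
      if s (k, j) = 1 ∧ s (k, j + 1) = 0 ∧ Jmap ξ k j = 1 then (1 : ℝ) else 0 := by
    intro j
    rw [fluxUp, ← Finset.sum_boole, ← sum_range_natCast_zmod]
  have hdown : ∀ j, (fluxDown ξ σ0 t j : ℝ) = ∑ k : ZMod R,
      if s (k, j) = 1 ∧ s (k, j - 1) = 0 ∧ Jmap ξ k (j - 1) = 1 then (1 : ℝ) else 0 := by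
    intro j
    rw [fluxDown, ← Finset.sum_boole, ← sum_range_natCast_zmod]
  rw [hnow, hnext, hup, hup, hdown, hdown]
  simp only [← Finset.sum_sub_distrib, ← Finset.sum_add_distrib]
  refine Finset.sum_congr rfl fun k _ => ?_
  rw [invFun_tau_add_one, add_sub_cancel_right, sub_add_cancel]
  have hJ : Jmap ξ k (i - 1) = 1 → Jmap ξ k i ≠ 1 := fun h => by
    simpa using Jmap_succ_ne_one ξ h
  by_cases h1 : Jmap ξ k i = 1
  · have h2 : Jmap ξ k (i - 1) ≠ 1 := fun h => hJ h h1
    rcases hs1 (k, i) with h | h <;> rcases hs1 (k, i + 1) with h' | h' <;>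
      simp [h1, h2, h, h']
  · by_cases h2 : Jmap ξ k (i - 1) = 1
    · rcases hs1 (k, i) with h | h <;> rcases hs1 (k, i - 1) with h' | h' <;>
        simp [h1, h2, h, h']
    · simp [h1, h2]
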